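/- Let n ≥ 1 and let B be a symmetric bilinear form on ℝⁿ that is positive definite and takes integer values on ℤⁿ. Fix an integer k ≥ 1 and h ∈ ℂⁿ. Then the function τ ↦ θ_k(τ, h) is complex differentiable (holomorphic) on the open set {τ ∈ ℂ : Im τ > 0}. -/

import Mathlib

noncomputable section

/-- An integer vector viewed inside `ℂⁿ`. -/
def zc {n : ℕ} (β : Fin n → ℤ) : Fin n → ℂ := fun i => (β i : ℂ)

/-- A real vector viewed inside `ℂⁿ`. -/
def rc {n : ℕ} (x : Fin n → ℝ) : Fin n → ℂ := fun i => (x i : ℂ)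

/-- The `β`-th term of the level `k` theta series:
`exp(2πik·B(β, h) + πik·τ·B(β, β))`. -/
def thetaTerm {n : ℕ} (B : (Fin n → ℂ) →ₗ[ℂ] (Fin n → ℂ) →ₗ[ℂ] ℂ)
    (k : ℤ) (τ : ℂ) (h : Fin n → ℂ) (β : Fin n → ℤ) : ℂ :=
  Complex.exp (2 * (Real.pi : ℂ) * Complex.I * (k : ℂ) * B (zc β) h
    + (Real.pi : ℂ) * Complex.I * (k : ℂ) * τ * B (zc β) (zc β))

/-- The level `k` theta function `θ_k(τ, h) = Σ_{β ∈ ℤⁿ} exp(2πik·B(β, h) + πik·τ·B(β, β))`. -/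
def theta {n : ℕ} (B : (Fin n → ℂ) →ₗ[ℂ] (Fin n → ℂ) →ₗ[ℂ] ℂ)
    (k : ℤ) (τ : ℂ) (h : Fin n → ℂ) : ℂ :=
  ∑' β : Fin n → ℤ, thetaTerm B k τ h β

/-- A product of summable nonnegative functions of one coordinate each is summable. -/
theorem summable_prod_apply_of_nonneg {ι κ : Type*} [Fintype ι] {f : κ → ℝ}
    (hf : ∀ m, 0 ≤ f m) (hs : Summable f) : Summable fun β : ι → κ => ∏ i, f (β i) := by
  classical
  refine summable_of_sum_le (c := ∏ _i : ι, ∑' m, f m)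
    (fun β => Finset.prod_nonneg fun i _ => hf _) fun u => ?_
  calc ∑ β ∈ u, ∏ i, f (β i)
      ≤ ∑ β ∈ Fintype.piFinset fun i => u.image fun β => β i, ∏ i, f (β i) := by
        refine Finset.sum_le_sum_of_subset_of_nonneg (fun β hβ => ?_)
          fun β _ _ => Finset.prod_nonneg fun i _ => hf _
        exact Fintype.mem_piFinset.2 fun i => Finset.mem_image_of_mem _ hβ
    _ = ∏ i, ∑ m ∈ u.image fun β => β i, f m := (Finset.prod_univ_sum _ _).symm
    _ ≤ ∏ _i : ι, ∑' m, f m :=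
        Finset.prod_le_prod (fun i _ => Finset.sum_nonneg fun m _ => hf m)
          fun i _ => hs.sum_le_tsum _ fun m _ => hf m

/-- A positive definite bilinear form dominates a multiple of the sum of squares. -/
theorem exists_pos_mul_sum_sq_le {ι : Type*} [Fintype ι]
    (b : (ι → ℝ) →ₗ[ℝ] (ι → ℝ) →ₗ[ℝ] ℝ) (hpos : ∀ x, x ≠ 0 → 0 < b x x) :
    ∃ c : ℝ, 0 < c ∧ ∀ x, c * ∑ i, x i ^ 2 ≤ b x x := by
  have hcont : Continuous fun x => b x x := by
    have : Continuous fun x => LinearMap.toContinuousLinearMap (b x) :=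
      (LinearMap.toContinuousLinearMap.toLinearMap ∘ₗ b).continuous_of_finiteDimensional
    simpa using this.clm_apply continuous_id
  obtain ⟨c, hc, hle⟩ := (isCompact_sphere (0 : ι → ℝ) 1).exists_forall_le' hcont.continuousOn
    (a := 0) fun x hx => hpos x (ne_zero_of_mem_unit_sphere ⟨x, hx⟩)
  have hnorm : ∀ x, c * ‖x‖ ^ 2 ≤ b x x := by
    intro x
    rcases eq_or_ne x 0 with rfl | hx
    · simp
    have hx' : 0 < ‖x‖ := norm_pos_iff.2 hx
    have h := hle (‖x‖⁻¹ • x) (by simp [norm_smul, hx'.ne'])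
    simp only [map_smul, LinearMap.smul_apply, smul_eq_mul] at h
    calc c * ‖x‖ ^ 2 ≤ (‖x‖⁻¹ * (‖x‖⁻¹ * b x x)) * ‖x‖ ^ 2 := by gcongr
      _ = b x x := by field_simp
  refine ⟨c / (Fintype.card ι + 1), by positivity, fun x => le_trans ?_ (hnorm x)⟩
  have hsum : ∑ i, x i ^ 2 ≤ (Fintype.card ι + 1) * ‖x‖ ^ 2 := by
    calc ∑ i, x i ^ 2 ≤ ∑ _i : ι, ‖x‖ ^ 2 :=
          Finset.sum_le_sum fun i _ => sq_le_sq.2 (by simpa using norm_le_pi_norm x i)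
      _ ≤ (Fintype.card ι + 1) * ‖x‖ ^ 2 := by
          simp only [Finset.sum_const, Finset.card_univ, nsmul_eq_mul]
          gcongr
          linarith
  rw [div_mul_eq_mul_div, div_le_iff₀ (by positivity)]
  nlinarith

/-- A linear functional on `ℂⁿ` grows at most linearly on integer vectors. -/
theorem norm_apply_zc_le {n : ℕ} (f : (Fin n → ℂ) →ₗ[ℂ] ℂ) (β : Fin n → ℤ) :
    ‖f (zc β)‖ ≤ (∑ i, ‖f (Pi.single i 1)‖) * ∑ i, |(β i : ℝ)| := by
  rw [LinearMap.pi_apply_eq_sum_univ f, Finset.mul_sum]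
  refine (norm_sum_le _ _).trans (Finset.sum_le_sum fun i _ => ?_)
  have hi : (fun j => if i = j then (1 : ℂ) else 0) = Pi.single i 1 := by
    ext j
    simp [Pi.single_apply, eq_comm]
  rw [hi, smul_eq_mul, norm_mul, mul_comm]
  have hβ : ‖zc β i‖ = |(β i : ℝ)| := by simp [zc]
  rw [hβ]
  gcongr
  exact Finset.single_le_sum (f := fun i => ‖f (Pi.single i 1)‖) (fun _ _ => norm_nonneg _)
    (Finset.mem_univ i)

/-- The theta series is dominated, uniformly on `{τ | t ≤ Im τ}`, by a product of summable
one-variable Gaussians. -/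
theorem norm_thetaTerm_le {n : ℕ} {B : (Fin n → ℂ) →ₗ[ℂ] (Fin n → ℂ) →ₗ[ℂ] ℂ}
    {h : Fin n → ℂ} {β : Fin n → ℤ} {k : ℤ} (hk : 0 ≤ k) {q c t : ℝ} (ht : 0 ≤ t)
    (hq : B (zc β) (zc β) = q) (hc : 0 ≤ c) (hcq : c * ∑ i, (β i : ℝ) ^ 2 ≤ q)
    {τ : ℂ} (hτ : t ≤ τ.im) :
    ‖thetaTerm B k τ h β‖ ≤ ∏ i, Real.exp (-Real.pi * (k * t * c * (β i : ℝ) ^ 2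
      - 2 * (k * ∑ j, ‖B (Pi.single j 1) h‖) * |(β i : ℝ)|)) := by
  have hk' : (0 : ℝ) ≤ k := by exact_mod_cast hk
  have hlin := norm_apply_zc_le (B.flip h) β
  simp only [LinearMap.flip_apply] at hlin
  rw [thetaTerm, Complex.norm_exp, ← Real.exp_sum, Real.exp_le_exp, ← Finset.mul_sum,
    Finset.sum_sub_distrib, ← Finset.mul_sum, ← Finset.mul_sum, hq]
  have hre : (2 * (Real.pi : ℂ) * Complex.I * (k : ℂ) * B (zc β) h
      + (Real.pi : ℂ) * Complex.I * (k : ℂ) * τ * q).re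
      = Real.pi * k * (2 * -(B (zc β) h).im - τ.im * q) := by
    simp
    ring
  rw [hre]
  have him := (neg_le_abs _).trans ((Complex.abs_im_le_norm _).trans hlin)
  have hS : 0 ≤ ∑ i, (β i : ℝ) ^ 2 := by positivity
  have hquad : t * (c * ∑ i, (β i : ℝ) ^ 2) ≤ τ.im * q :=
    mul_le_mul hτ hcq (by positivity) (ht.trans hτ)
  calc Real.pi * k * (2 * -(B (zc β) h).im - τ.im * q)
      ≤ Real.pi * k * (2 * ((∑ j, ‖B (Pi.single j 1) h‖) * ∑ i, |(β i : ℝ)|)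
        - t * (c * ∑ i, (β i : ℝ) ^ 2)) := by gcongr
    _ = _ := by ring

/-- For fixed `k ≥ 1` and `h ∈ ℂⁿ`, the theta function `τ ↦ θ_k(τ, h)` is complex
differentiable (holomorphic) at every point of the open upper half plane
`{τ : ℂ | 0 < Im τ}`. -/
theorem statement12 (n : ℕ) (hn : 1 ≤ n)
    (Bℝ : (Fin n → ℝ) →ₗ[ℝ] (Fin n → ℝ) →ₗ[ℝ] ℝ)
    (hsymm : ∀ x y : Fin n → ℝ, Bℝ x y = Bℝ y x)
    (hpos : ∀ x : Fin n → ℝ, x ≠ 0 → 0 < Bℝ x x)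
    (hint : ∀ β γ : Fin n → ℤ, ∃ m : ℤ,
      Bℝ (fun i => (β i : ℝ)) (fun i => (γ i : ℝ)) = (m : ℝ))
    (B : (Fin n → ℂ) →ₗ[ℂ] (Fin n → ℂ) →ₗ[ℂ] ℂ)
    (hext : ∀ x y : Fin n → ℝ, B (rc x) (rc y) = (Bℝ x y : ℂ))
    (k : ℤ) (hk : 1 ≤ k)
    (h : Fin n → ℂ) :
    ∀ τ : ℂ, 0 < τ.im → DifferentiableAt ℂ (fun τ : ℂ => theta B k τ h) τ := by
  intro τ₀ hτ₀
  obtain ⟨c, hc, hle⟩ := exists_pos_mul_sum_sq_le Bℝ hpos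
  have hk' : (0 : ℝ) < k := by exact_mod_cast hk
  have hopen : IsOpen {τ : ℂ | τ₀.im / 2 < τ.im} := isOpen_lt continuous_const Complex.continuous_im
  have hgauss := summable_pow_mul_jacobiTheta₂_term_bound
    (k * ∑ j, ‖B (Pi.single j 1) h‖) (T := k * (τ₀.im / 2) * c) (by positivity) 0
  simp only [pow_zero, one_mul, Int.cast_abs] at hgauss
  refine (Complex.differentiableOn_tsum_of_summable_norm (F := fun β τ => thetaTerm B k τ h β)
    (summable_prod_apply_of_nonneg (ι := Fin n) (fun _ => (Real.exp_pos _).le) hgauss)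
    (fun β => ?_) hopen fun β τ hτ => ?_).differentiableAt
    (hopen.mem_nhds (half_lt_self hτ₀))
  · unfold thetaTerm
    fun_prop
  · have hzc : zc β = rc fun i => (β i : ℝ) := by
      ext i
      simp [zc, rc]
    exact norm_thetaTerm_le (zero_le_one.trans hk) (half_pos hτ₀).le (hzc ▸ hext _ _) hc.le
      (hle _) (le_of_lt hτ)
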